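/- arXiv:1604.04123 — 3 statements merged into one kernel-verified Lean document; each statement's English description precedes it below -/
import Mathlib

section
/- Assume n and m are not both odd, let μ ∈ X⁺₀(n) and ν ∈ X⁺₀(m) correspond to (w,l) ∈ L⁺₀(n) and (w',l') ∈ L⁺₀(m) with l₁ > l'₁ and l_i ≠ l'_j for all pairs (i,j), let a be the position tuple with jump indices j₁ < … < j_k (j₀ := 0, j_{k+1} := m), λ_j := ν_j + a_j − j, κ := (w+w'+1)/2 and L := (1/2)·min{|l_i − l'_j|}. Then t ∈ (m+n)/2 + ℤ satisfies |t − κ| < L + 1/2 if and only if the integer s := t + (n−m)/2 − 1 satisfies, for every ρ = 1,…,k+1, the chain of inequalities μ̌_{a_{j_ρ}} ≥ λ_{1+j_{ρ−1}} − s ≥ λ_{2+j_{ρ−1}} − s ≥ … ≥ λ_{j_ρ} − s ≥ μ̌_{1+a_{j_ρ}}. Furthermore, for every ρ the inequalities among the listed λ-components are strict: λ_{1+j_{ρ−1}} > λ_{2+j_{ρ−1}} > … > λ_{j_ρ}. Here μ̌_i := −μ_{n+1−i}. -/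
/-- `(w, l) ∈ L⁺₀(n)`. -/
def IsLanglandsParam (n : ℕ) (w : ℤ) (l : ℕ → ℤ) : Prop :=
  (∀ i, 1 ≤ i → i < n → l (i + 1) < l i) ∧
  (∀ i, 1 ≤ i → i ≤ n → l i + l (n + 1 - i) = 0) ∧
  (∀ i, 1 ≤ i → i ≤ n → (w + l i) % 2 = ((n : ℤ) + 1) % 2)

/-- `μ` is dominant with purity weight `W`. -/
def IsDominantPure (n : ℕ) (μ : ℕ → ℤ) (W : ℤ) : Prop :=
  (∀ i, 1 ≤ i → i < n → μ (i + 1) ≤ μ i) ∧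
  (∀ i, 1 ≤ i → i ≤ n → μ i + μ (n + 1 - i) = W)

/-- The weight `μ ∈ X⁺₀(n)` corresponds to `(w, l) ∈ L⁺₀(n)`. -/
def Corresponds (n : ℕ) (w : ℤ) (l : ℕ → ℤ) (μ : ℕ → ℤ) : Prop :=
  w = μ 1 + μ n ∧
  ∀ i, 1 ≤ i → i ≤ n → l i = 2 * μ i + (n : ℤ) + 1 - w - 2 * (i : ℤ)

/-- `a` is the position tuple. -/
def IsPositionTuple (n m : ℕ) (l l' : ℕ → ℤ) (a : ℕ → ℕ) : Prop :=
  ∀ j, 1 ≤ j → j ≤ m →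
    1 ≤ a j ∧ a j ≤ n - 1 ∧ l' j < l (a j) ∧ l (1 + a j) ≤ l' j

/-- `j ∈ {1, …, m-1}` is a jump index of `a` when `a_j < a_{j+1}`. -/
def IsJumpIdx (m : ℕ) (a : ℕ → ℕ) (j : ℕ) : Prop :=
  1 ≤ j ∧ j ≤ m - 1 ∧ a j < a (j + 1)

/-- `J 1 < J 2 < … < J k` enumerates the jump indices of `a`, with the conventions
`J 0 = 0` and `J (k+1) = m`. -/
def JumpEnum (m : ℕ) (a : ℕ → ℕ) (k : ℕ) (J : ℕ → ℕ) : Prop :=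
  (∀ c₁ c₂, 1 ≤ c₁ → c₁ < c₂ → c₂ ≤ k → J c₁ < J c₂) ∧
  (∀ c, 1 ≤ c → c ≤ k → IsJumpIdx m a (J c)) ∧
  (∀ j, IsJumpIdx m a j → ∃ c, 1 ≤ c ∧ c ≤ k ∧ J c = j) ∧
  J 0 = 0 ∧ J (k + 1) = m

theorem critical_iff_chain_inequalities_nonexceptional
    (n m : ℕ) (hn : 1 ≤ n) (hm : 1 ≤ m) (hnm : ¬(Odd n ∧ Odd m))
    (w w' : ℤ) (l l' : ℕ → ℤ) (μ ν : ℕ → ℤ)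
    (hl : IsLanglandsParam n w l) (hl' : IsLanglandsParam m w' l')
    (hμ : IsDominantPure n μ w) (hν : IsDominantPure m ν w')
    (hcorr : Corresponds n w l μ) (hcorr' : Corresponds m w' l' ν)
    (hfirst : l' 1 < l 1)
    (hdisj : ∀ i ∈ Finset.Icc 1 n, ∀ j ∈ Finset.Icc 1 m, l i ≠ l' j)
    (a : ℕ → ℕ) (ha : IsPositionTuple n m l l' a)
    (k : ℕ) (J : ℕ → ℕ) (hJ : JumpEnum m a k J)
    (lam : ℕ → ℤ) (hlam : ∀ j, lam j = ν j + (a j : ℤ) - (j : ℤ))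
    (μd : ℕ → ℤ) (hμd : ∀ i, μd i = - μ (n + 1 - i))
    (κ L : ℚ) (hκ : κ = ((w : ℚ) + w' + 1) / 2)
    -- `L` is half the minimum of `|l_i - l'_j|` over all `1 ≤ i ≤ n`, `1 ≤ j ≤ m`:
    (hLlb : ∀ i ∈ Finset.Icc 1 n, ∀ j ∈ Finset.Icc 1 m, L ≤ (|l i - l' j| : ℚ) / 2)
    (hLmem : ∃ i ∈ Finset.Icc 1 n, ∃ j ∈ Finset.Icc 1 m, L = (|l i - l' j| : ℚ) / 2)
    (t : ℚ) (ht : ∃ z : ℤ, t = ((m : ℚ) + n) / 2 + z)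
    (s : ℤ) (hs : (s : ℚ) = t + ((n : ℚ) - m) / 2 - 1) :
    -- the criterion: the chains `(S_ρ)` for `ρ = 1, …, k+1`
    (|t - κ| < L + 1 / 2 ↔
      ∀ ρ, 1 ≤ ρ → ρ ≤ k + 1 →
        (lam (1 + J (ρ - 1)) - s ≤ μd (a (J ρ)) ∧
         (∀ j, 1 + J (ρ - 1) ≤ j → j < J ρ → lam (j + 1) - s ≤ lam j - s) ∧
         μd (1 + a (J ρ)) ≤ lam (J ρ) - s)) ∧
    -- the listed λ-components are strictly decreasing
    (∀ ρ, 1 ≤ ρ → ρ ≤ k + 1 →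
      ∀ j, 1 + J (ρ - 1) ≤ j → j < J ρ → lam (j + 1) < lam j) := by
  obtain ⟨hl1, hl2, hl3⟩ := hl
  obtain ⟨hl1', hl2', hl3'⟩ := hl'
  obtain ⟨hμ1, hμ2⟩ := hμ
  obtain ⟨hc1, hc2⟩ := hcorr
  obtain ⟨hc1', hc2'⟩ := hcorr'
  obtain ⟨hJ1, hJ2, hJ3, hJ0, hJm⟩ := hJ
  -- antitone l
  have hanti : ∀ i i', 1 ≤ i → i ≤ i' → i' ≤ n → l i' ≤ l i := by
    intro i i' h1 h2
    induction i', h2 using Nat.le_induction with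
    | base => intro _; exact le_refl _
    | succ q hq ih =>
      intro h3
      have := ih (by omega)
      have := hl1 q (by omega) (by omega)
      omega
  have hamono : ∀ j, 1 ≤ j → j < m → a j ≤ a (j + 1) := by
    intro j h1 h2
    by_contra hlt
    obtain ⟨p1, p2, p3, p4⟩ := ha j h1 (by omega)
    obtain ⟨q1, q2, q3, q4⟩ := ha (j+1) (by omega) (by omega)
    have := hanti (1 + a (j+1)) (a j) (by omega) (by omega) (by omega)
    have := hl1' j h1 h2
    omega
  have hJs : ∀ c₁ c₂, c₁ < c₂ → c₂ ≤ k + 1 → J c₁ < J c₂ := by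
    intro c₁ c₂ h1 h2
    rcases Nat.eq_zero_or_pos c₁ with rfl | h
    · rw [hJ0]
      rcases Nat.lt_or_ge k c₂ with h' | h'
      · have : c₂ = k + 1 := by omega
        rw [this, hJm]; omega
      · exact (hJ2 c₂ (by omega) h').1
    · rcases Nat.lt_or_ge k c₂ with h' | h'
      · have : c₂ = k + 1 := by omega
        rw [this, hJm]
        have := (hJ2 c₁ (by omega) (by omega)).2.1
        omega
      · exact hJ1 _ _ h h1 h'
  have hJle : ∀ c, c ≤ k + 1 → J c ≤ m := by
    intro c hc
    rcases Nat.lt_or_ge c (k+1) with h | h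
    · have := hJs c (k+1) h le_rfl
      omega
    · have : c = k + 1 := by omega
      rw [this, hJm]
  have hstep : ∀ ρ, 1 ≤ ρ → ρ ≤ k + 1 → ∀ j, 1 + J (ρ - 1) ≤ j → j < J ρ → a (j + 1) = a j := by
    intro ρ h1 h2 j h3 h4
    have hm' := hJle ρ h2
    have := hamono j (by omega) (by omega)
    by_contra hne
    obtain ⟨c, c1, c2, c3⟩ := hJ3 j ⟨by omega, by omega, by omega⟩
    have e1 : ρ - 1 < c := by
      by_contra hh
      rcases Nat.lt_or_ge c (ρ - 1) with h | h
      · have := hJs c (ρ-1) h (by omega); omega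
      · have : c = ρ - 1 := by omega
        subst this; omega
    have e2 : c < ρ := by
      by_contra hh
      rcases Nat.lt_or_ge ρ c with h | h
      · have := hJs ρ c h (by omega); omega
      · have : c = ρ := by omega
        subst this; omega
    omega
  have hconst : ∀ ρ, 1 ≤ ρ → ρ ≤ k + 1 → ∀ j, 1 + J (ρ - 1) ≤ j → ∀ j', j ≤ j' → j' ≤ J ρ →
      a j' = a j := by
    intro ρ h1 h2 j h3 j' h4
    induction j', h4 using Nat.le_induction with
    | base => intro _; rfl
    | succ q hq ih =>
      intro h5
      rw [hstep ρ h1 h2 q (by omega) (by omega)]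
      exact ih (by omega)
  have hlam2 : ∀ j, 1 ≤ j → j ≤ m → 2 * lam j = l' j - m - 1 + w' + 2 * a j := by
    intro j h1 h2
    have := hc2' j h1 h2
    have := hlam j
    omega
  have hmd2 : ∀ i, 1 ≤ i → i ≤ n → 2 * μd i = l i - n - 1 - w + 2 * i := by
    intro i h1 h2
    have := hc2 i h1 h2
    have := hμd i
    have := hμ2 i h1 h2
    omega
  have hstrict : ∀ ρ, 1 ≤ ρ → ρ ≤ k + 1 →
      ∀ j, 1 + J (ρ - 1) ≤ j → j < J ρ → lam (j + 1) < lam j := by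
    intro ρ h1 h2 j h3 h4
    have hm' := hJle ρ h2
    have := hstep ρ h1 h2 j h3 h4
    have := hlam2 j (by omega) (by omega)
    have := hlam2 (j+1) (by omega) (by omega)
    have := hl1' j (by omega) (by omega)
    omega
  have hlanti' : ∀ j j', 1 ≤ j → j ≤ j' → j' ≤ m → l' j' ≤ l' j := by
    intro i i' h1 h2
    induction i', h2 using Nat.le_induction with
    | base => intro _; exact le_refl _
    | succ q hq ih =>
      intro h3
      have := ih (by omega)
      have := hl1' q (by omega) (by omega)
      omega
  have hcover : ∀ j, 1 ≤ j → j ≤ m → ∃ ρ, 1 ≤ ρ ∧ ρ ≤ k + 1 ∧ 1 + J (ρ - 1) ≤ j ∧ j ≤ J ρ := by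
    intro j h1 h2
    classical
    have hex : ∃ ρ, j ≤ J ρ := ⟨k + 1, by omega⟩
    have hsp := Nat.find_spec hex
    have hle : Nat.find hex ≤ k + 1 := Nat.find_min' hex (by omega)
    have hpos : 1 ≤ Nat.find hex := by
      by_contra h0
      have : Nat.find hex = 0 := by omega
      rw [this, hJ0] at hsp
      omega
    have hmin := Nat.find_min hex (m := Nat.find hex - 1) (by omega)
    exact ⟨Nat.find hex, hpos, hle, by omega, hsp⟩
  obtain ⟨d, hd⟩ : ∃ d : ℤ, d = 2 * s - n + m + 1 - w - w' := ⟨_, rfl⟩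
  have hdq : t - κ = (d : ℚ) / 2 := by
    rw [hd, hκ]; push_cast; linarith
  have habs : |t - κ| = ((|d| : ℤ) : ℚ) / 2 := by
    rw [hdq, abs_div]; push_cast; norm_num
  have hkey : |t - κ| < L + 1 / 2 ↔ ∀ i, 1 ≤ i → i ≤ n → ∀ j, 1 ≤ j → j ≤ m →
      |d| < |l i - l' j| + 1 := by
    rw [habs]
    constructor
    · intro h i i1 i2 j j1 j2
      have h2 := hLlb i (Finset.mem_Icc.2 ⟨i1, i2⟩) j (Finset.mem_Icc.2 ⟨j1, j2⟩)
      have h3 : ((|d| : ℤ) : ℚ) < ((|l i - l' j| + 1 : ℤ) : ℚ) := by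
        push_cast at h ⊢; linarith
      exact_mod_cast h3
    · intro h
      obtain ⟨i, hi, j, hj, hL⟩ := hLmem
      rw [Finset.mem_Icc] at hi hj
      have h2 := h i hi.1 hi.2 j hj.1 hj.2
      have h3 : ((|d| : ℤ) : ℚ) < ((|l i - l' j| + 1 : ℤ) : ℚ) := by exact_mod_cast h2
      push_cast at h3 ⊢; linarith
  refine ⟨?_, hstrict⟩
  rw [hkey]
  constructor
  · intro h ρ h1 h2
    have hm' := hJle ρ h2
    have hlt := hJs (ρ - 1) ρ (by omega) h2
    refine ⟨?_, fun j h3 h4 => ?_, ?_⟩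
    · have hj1 : 1 ≤ 1 + J (ρ - 1) := by omega
      have hj2 : 1 + J (ρ - 1) ≤ m := by omega
      have e := hconst ρ h1 h2 _ le_rfl (J ρ) (by omega) le_rfl
      obtain ⟨p1, p2, p3, p4⟩ := ha _ hj1 hj2
      rw [e]
      have := hlam2 _ hj1 hj2
      have := hmd2 (a (1 + J (ρ - 1))) p1 (by omega)
      have q1 := h _ p1 (by omega) _ hj1 hj2
      rw [abs_of_pos (a := l _ - l' _) (by omega)] at q1
      have := neg_abs_le d
      omega
    · have := hstrict ρ h1 h2 j h3 h4
      omega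
    · have hj1 : 1 ≤ J ρ := by omega
      obtain ⟨p1, p2, p3, p4⟩ := ha _ hj1 hm'
      have := hlam2 _ hj1 hm'
      have := hmd2 (1 + a (J ρ)) (by omega) (by omega)
      have q1 := h (1 + a (J ρ)) (by omega) (by omega) _ hj1 hm'
      rw [abs_of_nonpos (a := l _ - l' _) (by omega)] at q1
      have := le_abs_self d
      push_cast at *
      omega
  · intro h
    have hA : ∀ j, 1 ≤ j → j ≤ m → 1 - d ≤ l (a j) - l' j ∧ 1 + d ≤ l' j - l (1 + a j) := by
      intro j j1 j2
      obtain ⟨ρ, h1, h2, h3, h4⟩ := hcover j j1 j2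
      obtain ⟨c1, -, c3⟩ := h ρ h1 h2
      have hm' := hJle ρ h2
      have e1 := hconst ρ h1 h2 j h3 (J ρ) h4 le_rfl
      have e2 := hconst ρ h1 h2 _ le_rfl j h3 h4
      rw [e1] at c1 c3
      obtain ⟨p1, p2, p3, p4⟩ := ha j j1 j2
      have := hlanti' _ j (by omega) h3 j2
      have := hlanti' j (J ρ) (by omega) h4 hm'
      have := hlam2 _ (by omega : 1 ≤ 1 + J (ρ - 1)) (by omega)
      have := hlam2 (J ρ) (by omega) hm'
      have := hmd2 (a j) p1 (by omega)
      have := hmd2 (1 + a j) (by omega) (by omega)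
      push_cast at *
      rw [e1] at *
      rw [← e2] at *
      constructor <;> omega
    have hB : ∀ i, 1 ≤ i → i ≤ n → ∀ j, 1 ≤ j → j ≤ m →
        (l' j < l i → 1 - d ≤ l i - l' j) ∧ (l i < l' j → 1 + d ≤ l' j - l i) := by
      intro i i1 i2 j j1 j2
      obtain ⟨p1, p2, p3, p4⟩ := ha j j1 j2
      obtain ⟨q1, q2⟩ := hA j j1 j2
      rcases Nat.lt_or_ge (a j) i with hh | hh
      · have := hanti (1 + a j) i (by omega) (by omega) i2
        constructor <;> intro _ <;> omega
      · have := hanti i (a j) (by omega) (by omega) (by omega)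
        constructor <;> intro _ <;> omega
    intro i i1 i2 j j1 j2
    obtain ⟨b1, b2⟩ := hB i i1 i2 j j1 j2
    obtain ⟨b3, b4⟩ := hB (n + 1 - i) (by omega) (by omega) (m + 1 - j) (by omega) (by omega)
    have s1 := hl2 i i1 i2
    have s2 := hl2' j j1 j2
    have hne := hdisj i (Finset.mem_Icc.2 ⟨i1, i2⟩) j (Finset.mem_Icc.2 ⟨j1, j2⟩)
    rcases lt_or_gt_of_ne hne with hh | hh
    · rw [abs_of_neg (a := l i - l' j) (by omega), abs_lt]
      constructor <;> omega
    · rw [abs_of_pos (a := l i - l' j) (by omega), abs_lt]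
      constructor <;> omega
end

section
/- Assume n and m are not both odd, let μ ∈ X⁺₀(n) and ν ∈ X⁺₀(m) correspond to (w,l) ∈ L⁺₀(n) and (w',l') ∈ L⁺₀(m) with l₁ > l'₁ and l_i ≠ l'_j for all pairs (i,j), let a be the position tuple with jump indices j₁ < … < j_k (j₀ := 0, j_{k+1} := m, r := k+1), let λ_j := ν_j + a_j − j, and for a fixed integer s define u, v ∈ ℤ^{2r} by u_{2ρ−1} := μ̌_{a_{j_ρ}}, u_{2ρ} := μ̌_{1+a_{j_ρ}}, v_{2ρ−1} := λ_{1+j_{ρ−1}} − s, v_{2ρ} := λ_{j_ρ} − s for ρ = 1,…,r, where μ̌_i := −μ_{n+1−i}. Then u and v are dominant weights with purity property, i.e. u, v ∈ X⁺₀(2r), of respective weights wt(u) = −w and wt(v) = w' + n − m − 1 − 2s. -/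
/-- `μ ∈ X⁺₀(n)`: dominant admitting some purity weight. -/
def MemX0 (n : ℕ) (μ : ℕ → ℤ) : Prop := ∃ W : ℤ, IsDominantPure n μ W

theorem aux_anti {n : ℕ} {l : ℕ → ℤ} (h : ∀ i, 1 ≤ i → i < n → l (i + 1) ≤ l i) :
    ∀ d i, 1 ≤ i → i + d ≤ n → l (i + d) ≤ l i := by
  intro d
  induction d with
  | zero => intro i _ _; simp
  | succ d ih =>
    intro i h1 h2
    have := ih i h1 (by omega)
    have h3 := h (i + d) (by omega) (by omega)
    rw [← add_assoc]; omega

theorem aux_anti' {n : ℕ} {l : ℕ → ℤ} (h : ∀ i, 1 ≤ i → i < n → l (i + 1) ≤ l i)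
    (i j : ℕ) (h1 : 1 ≤ i) (h2 : i ≤ j) (h3 : j ≤ n) : l j ≤ l i := by
  obtain ⟨d, rfl⟩ := Nat.exists_eq_add_of_le h2
  exact aux_anti h d i h1 h3

theorem weights_u_v_dominant_pure_nonexceptional
    (n m : ℕ) (hn : 1 ≤ n) (hm : 1 ≤ m) (hnm : ¬(Odd n ∧ Odd m))
    (w w' : ℤ) (l l' : ℕ → ℤ) (μ ν : ℕ → ℤ)
    (hl : IsLanglandsParam n w l) (hl' : IsLanglandsParam m w' l')
    (hμ : IsDominantPure n μ w) (hν : IsDominantPure m ν w')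
    (hcorr : Corresponds n w l μ) (hcorr' : Corresponds m w' l' ν)
    (hfirst : l' 1 < l 1)
    (hdisj : ∀ i ∈ Finset.Icc 1 n, ∀ j ∈ Finset.Icc 1 m, l i ≠ l' j)
    (a : ℕ → ℕ) (ha : IsPositionTuple n m l l' a)
    (k : ℕ) (J : ℕ → ℕ) (hJ : JumpEnum m a k J)
    (r : ℕ) (hr : r = k + 1)
    (lam : ℕ → ℤ) (hlam : ∀ j, lam j = ν j + (a j : ℤ) - (j : ℤ))
    (μd : ℕ → ℤ) (hμd : ∀ i, μd i = - μ (n + 1 - i))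
    (s : ℤ) (u v : ℕ → ℤ)
    (hu : ∀ ρ, 1 ≤ ρ → ρ ≤ r →
      u (2 * ρ - 1) = μd (a (J ρ)) ∧ u (2 * ρ) = μd (1 + a (J ρ)))
    (hv : ∀ ρ, 1 ≤ ρ → ρ ≤ r →
      v (2 * ρ - 1) = lam (1 + J (ρ - 1)) - s ∧ v (2 * ρ) = lam (J ρ) - s) :
    IsDominantPure (2 * r) u (-w) ∧
    IsDominantPure (2 * r) v (w' + (n : ℤ) - m - 1 - 2 * s) := by
  obtain ⟨hl1, hl2, -⟩ := hl
  obtain ⟨hl1', hl2', -⟩ := hl'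
  obtain ⟨hμ1, hμ2⟩ := hμ
  obtain ⟨hν1, hν2⟩ := hν
  obtain ⟨-, hc⟩ := hcorr
  obtain ⟨-, hc'⟩ := hcorr'
  obtain ⟨hJ1, hJ2, hJ3, hJ0, hJk⟩ := hJ
  have hmu := aux_anti' hμ1
  have hnu := aux_anti' hν1
  have hla := aux_anti' (fun i h1 h2 => (hl1 i h1 h2).le)
  have hs : ∀ j, 1 ≤ j → j ≤ m → 1 ≤ a j ∧ a j + 1 ≤ n ∧ l' j < l (a j) ∧ l (1 + a j) < l' j := by
    intro j h1 h2
    obtain ⟨b1, b2, b3, b4⟩ := ha j h1 h2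
    have := hdisj (1 + a j) (by simp; omega) j (by simp; omega)
    exact ⟨b1, by omega, b3, lt_of_le_of_ne b4 this⟩
  -- uniqueness of position
  have huniq : ∀ j, 1 ≤ j → j ≤ m → ∀ b, 1 ≤ b → b + 1 ≤ n → l' j < l b → l (1 + b) < l' j →
      a j = b := by
    intro j h1 h2 b b1 b2 b3 b4
    obtain ⟨c1, c2, c3, c4⟩ := hs j h1 h2
    rcases lt_trichotomy (a j) b with h | h | h
    · have := hla (1 + a j) b (by omega) (by omega) (by omega)
      omega
    · exact h
    · have := hla (1 + b) (a j) (by omega) (by omega) (by omega)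
      omega
  have hsym : ∀ j, 1 ≤ j → j ≤ m → a (m + 1 - j) + a j = n := by
    intro j h1 h2
    obtain ⟨c1, c2, c3, c4⟩ := hs j h1 h2
    have e1 := hl2' j h1 h2
    have e2 := hl2 (a j) c1 (by omega)
    have e3 := hl2 (1 + a j) (by omega) (by omega)
    have i1 : n + 1 - a j = 1 + (n - a j) := by omega
    have i2 : n + 1 - (1 + a j) = n - a j := by omega
    rw [i1] at e2
    rw [i2] at e3
    have := huniq (m + 1 - j) (by omega) (by omega) (n - a j) (by omega) (by omega)
      (by omega) (by omega)
    omega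
  have hamono : ∀ j, 1 ≤ j → j < m → a j ≤ a (j + 1) := by
    intro j h1 h2
    obtain ⟨c1, c2, c3, c4⟩ := hs j h1 h2.le
    obtain ⟨d1, d2, d3, d4⟩ := hs (j + 1) (by omega) (by omega)
    by_contra h
    have := hla (1 + a (j + 1)) (a j) (by omega) (by omega) (by omega)
    have := hl1' j h1 h2
    omega
  have hjsym : ∀ j, IsJumpIdx m a j → IsJumpIdx m a (m - j) := by
    rintro j ⟨h1, h2, h3⟩
    have e1 := hsym j h1 (by omega)
    have e2 := hsym (j + 1) (by omega) (by omega)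
    have i1 : m + 1 - j = m - j + 1 := by omega
    have i2 : m + 1 - (j + 1) = m - j := by omega
    rw [i1] at e1
    rw [i2] at e2
    exact ⟨by omega, by omega, by omega⟩
  have hJm : ∀ c d, c < d → d ≤ k + 1 → J c < J d := by
    intro c d h1 h2
    by_cases hc0 : c = 0
    · subst hc0
      by_cases hd : d = k + 1
      · subst hd; omega
      · have := (hJ2 d (by omega) (by omega)).1
        omega
    · by_cases hd : d = k + 1
      · subst hd
        have := (hJ2 c (by omega) (by omega)).2.1
        have := (hJ2 c (by omega) (by omega)).1
        omega
      · exact hJ1 c d (by omega) h1 (by omega)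
  have hJle : ∀ c d, c ≤ d → d ≤ k + 1 → J c ≤ J d := by
    intro c d h1 h2
    rcases h1.lt_or_eq with h | h
    · exact (hJm c d h h2).le
    · rw [h]
  have hJb : ∀ c, c ≤ k + 1 → J c ≤ m := by
    intro c h
    rw [← hJk]; exact hJle c _ h le_rfl
  have hJsym : ∀ c, c ≤ k + 1 → J c + J (k + 1 - c) = m := by
    intro c
    induction c with
    | zero => intro _; simp [hJ0, hJk]
    | succ c ih =>
      intro h
      have ih := ih (by omega)
      by_cases hck : c = k
      · subst hck; simp [hJ0, hJk]
      have i1 : k + 1 - (c + 1) = k - c := by omega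
      rw [i1]
      have b1 := hJb (c + 1) h
      have b2 := hJb (k - c) (by omega)
      have m1 := hJm c (c + 1) (by omega) (by omega)
      have m2 := hJm (k - c) (k + 1 - c) (by omega) (by omega)
      obtain ⟨x, x1, x2, x3⟩ := hJ3 _ (hjsym _ (hJ2 (c + 1) (by omega) (by omega)))
      obtain ⟨y, y1, y2, y3⟩ := hJ3 _ (hjsym _ (hJ2 (k - c) (by omega) (by omega)))
      have hx : x ≤ k - c := by
        by_contra hx
        have := hJle (k + 1 - c) x (by omega) (by omega)
        omega
      have hy : c + 1 ≤ y := by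
        by_contra hy
        have := hJle y c (by omega) (by omega)
        omega
      have := hJle x (k - c) hx (by omega)
      have := hJle (c + 1) y hy (by omega)
      omega
  have hblk : ∀ c, c ≤ k → ∀ d, J c + 1 + d ≤ J (c + 1) → a (J c + 1 + d) = a (J c + 1) := by
    intro c hck d
    induction d with
    | zero => intro _; rfl
    | succ d ih =>
      intro h
      rw [← ih (by omega)]
      have b := hJb (c + 1) (by omega)
      have h1 := hamono (J c + 1 + d) (by omega) (by omega)
      by_contra hne
      obtain ⟨x, x1, x2, x3⟩ := hJ3 (J c + 1 + d) ⟨by omega, by omega, by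
        have : J c + 1 + d + 1 = J c + 1 + (d + 1) := by omega
        rw [this] at h1 ⊢
        omega⟩
      rcases le_or_gt x c with hx | hx
      · have := hJle x c hx (by omega)
        omega
      · have := hJle (c + 1) x hx (by omega)
        omega
  have hblk' : ∀ c, c ≤ k → a (J (c + 1)) = a (1 + J c) := by
    intro c hck
    have := hJm c (c + 1) (by omega) (by omega)
    have h := hblk c hck (J (c + 1) - (J c + 1)) (by omega)
    rw [show J c + 1 + (J (c + 1) - (J c + 1)) = J (c + 1) by omega] at h
    rw [h, add_comm]
  have hud : ∀ i j, 1 ≤ i → i ≤ j → j ≤ n → μd j ≤ μd i := by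
    intro i j h1 h2 h3
    rw [hμd, hμd]
    have := hmu (n + 1 - j) (n + 1 - i) (by omega) (by omega) (by omega)
    omega
  have hup : ∀ i j, 1 ≤ i → i ≤ n → i + j = n + 1 → μd i + μd j = -w := by
    intro i j h1 h2 h3
    obtain rfl : j = n + 1 - i := by omega
    rw [hμd, hμd]
    have := hμ2 (n + 1 - i) (by omega) (by omega)
    omega
  have hlp : ∀ i j, 1 ≤ i → i ≤ m → i + j = m + 1 → lam i + lam j = w' + (n : ℤ) - m - 1 := by
    intro i j h1 h2 h3
    obtain rfl : j = m + 1 - i := by omega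
    rw [hlam, hlam]
    have e1 := hν2 i h1 h2
    have e2 := hsym i h1 h2
    omega
  have hgap : ∀ d i, 1 ≤ i → i + d ≤ n → 2 * (d : ℤ) ≤ l i - l (i + d) := by
    intro d i h1 h2
    have e1 := hc i h1 (by omega)
    have e2 := hc (i + d) (by omega) h2
    have := hmu i (i + d) h1 (by omega) h2
    push_cast at e2
    omega
  have hJrange : ∀ ρ, 1 ≤ ρ → ρ ≤ k + 1 → 1 ≤ J ρ ∧ J ρ ≤ m := by
    intro ρ h1 h2
    have := hJm 0 ρ (by omega) h2
    exact ⟨by omega, hJb ρ h2⟩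
  subst hr
  have hpair : ∀ ρ, 1 ≤ ρ → ρ ≤ k + 1 → ∃ σ, 1 ≤ σ ∧ σ ≤ k + 1 ∧ ρ + σ = k + 2 ∧
      u (2 * ρ - 1) + u (2 * σ) = -w ∧
      v (2 * ρ - 1) + v (2 * σ) = w' + (n : ℤ) - m - 1 - 2 * s := by
    intro ρ h1 h2
    obtain ⟨c, rfl⟩ : ∃ c, ρ = c + 1 := ⟨ρ - 1, by omega⟩
    refine ⟨k + 1 - c, by omega, by omega, by omega, ?_, ?_⟩
    · rw [(hu (c + 1) h1 h2).1, (hu (k + 1 - c) (by omega) (by omega)).2]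
      have e := hJsym c (by omega)
      have := hJm c (c + 1) (by omega) (by omega)
      have b := hJb (c + 1) (by omega)
      have e2 := hsym (1 + J c) (by omega) (by omega)
      rw [← hblk' c (by omega), show m + 1 - (1 + J c) = J (k + 1 - c) by omega] at e2
      obtain ⟨q1, q2, -, -⟩ := hs (J (c + 1)) (by omega) (by omega)
      exact hup _ _ q1 (by omega) (by omega)
    · rw [(hv (c + 1) h1 h2).1, (hv (k + 1 - c) (by omega) (by omega)).2]
      have e := hJsym c (by omega)
      have := hJm c (c + 1) (by omega) (by omega)
      have b := hJb (c + 1) (by omega)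
      have := hlp (1 + J c) (J (k + 1 - c)) (by omega) (by omega) (by omega)
      simp only [Nat.add_sub_cancel]
      omega
  have hpure : ∀ i, 1 ≤ i → i ≤ 2 * (k + 1) →
      u i + u (2 * (k + 1) + 1 - i) = -w ∧
      v i + v (2 * (k + 1) + 1 - i) = w' + (n : ℤ) - m - 1 - 2 * s := by
    intro i h1 h2
    rcases Nat.even_or_odd' i with ⟨t, rfl | rfl⟩
    · obtain ⟨σ, s1, s2, s3, s4, s5⟩ := hpair (k + 2 - t) (by omega) (by omega)
      obtain rfl : σ = t := by omega
      rw [show 2 * (k + 1) + 1 - 2 * σ = 2 * (k + 2 - σ) - 1 by omega]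
      exact ⟨by omega, by omega⟩
    · obtain ⟨σ, s1, s2, s3, s4, s5⟩ := hpair (t + 1) (by omega) (by omega)
      rw [show 2 * (k + 1) + 1 - (2 * t + 1) = 2 * σ by omega]
      rw [show 2 * (t + 1) - 1 = 2 * t + 1 by omega] at s4 s5
      exact ⟨s4, s5⟩
  have hdom : ∀ i, 1 ≤ i → i < 2 * (k + 1) → u (i + 1) ≤ u i ∧ v (i + 1) ≤ v i := by
    intro i h1 h2
    rcases Nat.even_or_odd' i with ⟨t, rfl | rfl⟩
    · have u1 := (hu t (by omega) (by omega)).2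
      have u2 := (hu (t + 1) (by omega) (by omega)).1
      have v1 := (hv t (by omega) (by omega)).2
      have v2 := (hv (t + 1) (by omega) (by omega)).1
      rw [show 2 * (t + 1) - 1 = 2 * t + 1 by omega] at u2 v2
      rw [Nat.add_sub_cancel] at v2
      rw [u1, u2, v1, v2, hblk' t (by omega)]
      obtain ⟨j1, j2, j3⟩ := hJ2 t (by omega) (by omega)
      rw [add_comm (J t) 1] at j3
      obtain ⟨p1, p2, p3, p4⟩ := hs (J t) (by omega) (by omega)
      obtain ⟨q1, q2, q3, q4⟩ := hs (1 + J t) (by omega) (by omega)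
      refine ⟨hud _ _ (by omega) (by omega) (by omega), ?_⟩
      rw [hlam, hlam]
      have g := hgap (a (1 + J t) - (1 + a (J t))) (1 + a (J t)) (by omega) (by omega)
      rw [show 1 + a (J t) + (a (1 + J t) - (1 + a (J t))) = a (1 + J t) by omega] at g
      have c1 := hc' (J t) (by omega) (by omega)
      have c2 := hc' (1 + J t) (by omega) (by omega)
      push_cast at c2 ⊢
      omega
    · have u1 := (hu (t + 1) (by omega) (by omega))
      have v1 := (hv (t + 1) (by omega) (by omega))
      rw [show 2 * (t + 1) - 1 = 2 * t + 1 by omega] at u1 v1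
      rw [Nat.add_sub_cancel] at v1
      rw [show 2 * t + 1 + 1 = 2 * (t + 1) by omega, u1.1, u1.2, v1.1, v1.2]
      have b := hJrange (t + 1) (by omega) (by omega)
      obtain ⟨p1, p2, p3, p4⟩ := hs (J (t + 1)) (by omega) (by omega)
      refine ⟨hud _ _ (by omega) (by omega) (by omega), ?_⟩
      rw [hlam, hlam, hblk' t (by omega)]
      have := hJm t (t + 1) (by omega) (by omega)
      have := hnu (1 + J t) (J (t + 1)) (by omega) (by omega) (by omega)
      push_cast
      omega
  exact ⟨⟨fun i h1 h2 => (hdom i h1 h2).1, fun i h1 h2 => (hpure i h1 h2).1⟩,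
    ⟨fun i h1 h2 => (hdom i h1 h2).2, fun i h1 h2 => (hpure i h1 h2).2⟩⟩
end

section
/- Assume the exceptional case n ≡ m ≡ 1 (mod 2) with (n,m) ≠ (1,1), let μ ∈ X⁺₀(n) and ν ∈ X⁺₀(m) correspond to (w,l) ∈ L⁺₀(n) and (w',l') ∈ L⁺₀(m) with l₁ > l'₁ and l_i ≠ l'_j for all (i,j) ≠ ((n+1)/2,(m+1)/2), let a be the position tuple with jump indices j₁ < … < j_k where k is odd (so r := k+1 is even), let λ_j := ν_j + a_j − j, and for a fixed integer s define u, v ∈ ℤ^{2r} by u_{2ρ−1} := μ̌_{a_{j_ρ}}, u_{2ρ} := μ̌_{1+a_{j_ρ}} for ρ = 1,…,r, v_{2ρ−1} := λ_{1+j_{ρ−1}} − s and v_{2ρ} := λ_{j_ρ} − s for all ρ ≠ r/2, and v_{r−1} := λ_{1+j_{(r/2)−1}} − s, v_r := λ_{j_{r/2}−1} − s, where μ̌_i := −μ_{n+1−i}. Then u and v belong to X⁺₀(2r), and moreover the defect of u vanishes: u_r = u_{r+1}. -/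
theorem aux_anti_s17 (n : ℕ) (f : ℕ → ℤ) (h : ∀ i, 1 ≤ i → i < n → f (i + 1) ≤ f i)
    (i i' : ℕ) (hi : 1 ≤ i) (hii : i ≤ i') (hn : i' ≤ n) : f i' ≤ f i := by
  induction i', hii using Nat.le_induction with
  | base => exact le_refl _
  | succ x hx ih =>
    have h1 := ih (by omega)
    have h2 := h x (by omega) (by omega)
    omega

theorem aux_santi (n : ℕ) (f : ℕ → ℤ) (h : ∀ i, 1 ≤ i → i < n → f (i + 1) < f i)
    (i i' : ℕ) (hi : 1 ≤ i) (hii : i < i') (hn : i' ≤ n) : f i' < f i := by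
  have h1 := h i hi (by omega)
  have h2 := aux_anti_s17 n f (fun i a b => (h i a b).le) (i+1) i' (by omega) hii hn
  omega

/-- position tuple properties -/
theorem aux_pos (N M : ℕ) (l l' : ℕ → ℤ) (w w' : ℤ)
    (hl : IsLanglandsParam (2*N+1) w l) (hl' : IsLanglandsParam (2*M+1) w' l')
    (hdisj : ∀ i ∈ Finset.Icc 1 (2*N+1), ∀ j ∈ Finset.Icc 1 (2*M+1),
      (i, j) ≠ ((2*N+1 + 1) / 2, (2*M+1 + 1) / 2) → l i ≠ l' j)
    (a : ℕ → ℕ) (ha : IsPositionTuple (2*N+1) (2*M+1) l l' a) :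
    (∀ j j', 1 ≤ j → j ≤ j' → j' ≤ 2*M+1 → a j ≤ a j') ∧
    (∀ j, 1 ≤ j → j ≤ 2*M+1 → j ≠ M+1 → a (2*M+2-j) + a j = 2*N+1) ∧
    a (M+1) = N ∧ (∀ j, M+1 < j → j ≤ 2*M+1 → N+1 ≤ a j) := by
  obtain ⟨h1, h2, h3⟩ := hl
  obtain ⟨h1', h2', h3'⟩ := hl'
  have lt_of : ∀ i i', 1 ≤ i → i ≤ 2*N+1 → 1 ≤ i' → i' ≤ 2*N+1 → l i' < l i → i < i' := by
    intro i i' hi hi2 hi' hi2' h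
    by_contra hc
    have := aux_anti_s17 (2*N+1) l (fun i a b => (h1 i a b).le) i' i hi' (by omega) hi2
    omega
  have le_of : ∀ i i', 1 ≤ i → i ≤ 2*N+1 → 1 ≤ i' → i' ≤ 2*N+1 → l i' ≤ l i → i ≤ i' := by
    intro i i' hi hi2 hi' hi2' h
    by_contra hc
    have := aux_santi (2*N+1) l h1 i' i hi' (by omega) hi2
    omega
  have l0 : l (N+1) = 0 := by
    have := h2 (N+1) (by omega) (by omega)
    rw [show 2*N+1+1-(N+1) = N+1 by omega] at this
    omega
  have l0' : l' (M+1) = 0 := by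
    have := h2' (M+1) (by omega) (by omega)
    rw [show 2*M+1+1-(M+1) = M+1 by omega] at this
    omega
  refine ⟨?_, ?_, ?_, ?_⟩
  · intro j j' hj hjj hj'
    obtain ⟨p1, p2, p3, p4⟩ := ha j hj (by omega)
    obtain ⟨q1, q2, q3, q4⟩ := ha j' (by omega) (by omega)
    have := aux_anti_s17 (2*M+1) l' (fun i a b => (h1' i a b).le) j j' hj hjj hj'
    have := lt_of (a j) (1 + a j') p1 (by omega) (by omega) (by omega) (by omega)
    omega
  · intro j hj hj2 hne
    obtain ⟨p1, p2, p3, p4⟩ := ha j hj (by omega)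
    obtain ⟨q1, q2, q3, q4⟩ := ha (2*M+2-j) (by omega) (by omega)
    have e1 := h2' j hj hj2
    have e2 := h2 (a j) p1 (by omega)
    have e3 := h2 (1 + a j) (by omega) (by omega)
    have hd := hdisj (1 + a j) (by simp; omega) j (by simp; omega) (by
      intro h
      simp only [Prod.mk.injEq] at h
      omega)
    have t1 := lt_of (a (2*M+2-j)) (2*N+1+1-a j) q1 (by omega) (by omega) (by omega) (by
      rw [show 2*M+1+1-j = 2*M+2-j by omega] at e1; omega)
    have t2 := lt_of (2*N+1+1-(1+a j)) (1 + a (2*M+2-j)) (by omega) (by omega) (by omega)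
      (by omega) (by
      rw [show 2*M+1+1-j = 2*M+2-j by omega] at e1; omega)
    omega
  · obtain ⟨p1, p2, p3, p4⟩ := ha (M+1) (by omega) (by omega)
    have t1 := lt_of (a (M+1)) (N+1) p1 (by omega) (by omega) (by omega) (by omega)
    have t2 := le_of (N+1) (1+a (M+1)) (by omega) (by omega) (by omega) (by omega) (by omega)
    omega
  · intro j hj hj2
    obtain ⟨p1, p2, p3, p4⟩ := ha j (by omega) (by omega)
    have := aux_santi (2*M+1) l' h1' (M+1) j (by omega) hj hj2
    have t2 := lt_of (N+1) (1+a j) (by omega) (by omega) (by omega) (by omega) (by omega)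
    omega

theorem aux_lam (N M : ℕ) (l l' μ ν : ℕ → ℤ) (w w' : ℤ)
    (hl : IsLanglandsParam (2*N+1) w l) (hl' : IsLanglandsParam (2*M+1) w' l')
    (hμ : IsDominantPure (2*N+1) μ w) (hν : IsDominantPure (2*M+1) ν w')
    (hcorr : Corresponds (2*N+1) w l μ) (hcorr' : Corresponds (2*M+1) w' l' ν)
    (a : ℕ → ℕ) (ha : IsPositionTuple (2*N+1) (2*M+1) l l' a)
    (amono : ∀ j j', 1 ≤ j → j ≤ j' → j' ≤ 2*M+1 → a j ≤ a j')
    (j : ℕ) (hj : 1 ≤ j) (hj2 : j < 2*M+1) :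
    ν (j+1) + (a (j+1) : ℤ) - ((j+1 : ℕ) : ℤ) ≤ ν j + (a j : ℤ) - (j : ℤ) := by
  have hm := amono j (j+1) hj (by omega) (by omega)
  have hn := hν.1 j hj hj2
  rcases hm.eq_or_lt with h | h
  · rw [h]; push_cast; omega
  obtain ⟨h1, h2, h3⟩ := hl
  obtain ⟨h1', h2', h3'⟩ := hl'
  have l0 : l (N+1) = 0 := by
    have := h2 (N+1) (by omega) (by omega)
    rw [show 2*N+1+1-(N+1) = N+1 by omega] at this
    omega
  have l0' : l' (M+1) = 0 := by
    have := h2' (M+1) (by omega) (by omega)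
    rw [show 2*M+1+1-(M+1) = M+1 by omega] at this
    omega
  have w0 := h3 (N+1) (by omega) (by omega)
  have w0' := h3' (M+1) (by omega) (by omega)
  obtain ⟨p1, p2, p3, p4⟩ := ha j hj (by omega)
  obtain ⟨q1, q2, q3, q4⟩ := ha (j+1) (by omega) (by omega)
  have c1 := h3 (a (j+1)) q1 (by omega)
  have c2 := h3' (j+1) (by omega) (by omega)
  have d1 := hcorr'.2 j hj (by omega)
  have d2 := hcorr'.2 (j+1) (by omega) (by omega)
  have d3 := hcorr.2 (1 + a j) (by omega) (by omega)
  have d4 := hcorr.2 (a (j+1)) q1 (by omega)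
  have d5 := aux_anti_s17 (2*N+1) μ hμ.1 (1 + a j) (a (j+1)) (by omega) (by omega) (by omega)
  push_cast at *
  omega

theorem aux_card_lt (m : ℕ) (a : ℕ → ℕ) (k : ℕ) (J : ℕ → ℕ) (hJ : JumpEnum m a k J)
    (c : ℕ) (hc : 1 ≤ c) (hck : c ≤ k) :
    Set.ncard {j | IsJumpIdx m a j ∧ j < J c} = c - 1 := by
  obtain ⟨h1, h2, h3, h4, h5⟩ := hJ
  have mono : ∀ x y, 1 ≤ x → x ≤ k → 1 ≤ y → y ≤ k → J x < J y → x < y := by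
    intro x y _ _ _ _ h
    by_contra hh
    rcases (not_lt.1 hh).eq_or_lt with e | e
    · subst e; omega
    · have := h1 y x ‹_› e ‹_›; omega
  have : {j | IsJumpIdx m a j ∧ j < J c} = J '' (Finset.Ico 1 c : Finset ℕ) := by
    ext j
    simp only [Set.mem_setOf_eq, Set.mem_image, Finset.coe_Ico, Set.mem_Ico]
    constructor
    · rintro ⟨p, q⟩
      obtain ⟨x, x1, x2, rfl⟩ := h3 j p
      exact ⟨x, ⟨x1, mono x c x1 x2 hc hck q⟩, rfl⟩
    · rintro ⟨x, ⟨x1, x2⟩, rfl⟩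
      exact ⟨h2 x x1 (by omega), h1 x c x1 x2 hck⟩
  rw [this, Set.ncard_image_of_injOn, Set.ncard_coe_finset, Nat.card_Ico]
  intro x hx y hy h
  simp only [Finset.coe_Ico, Set.mem_Ico] at hx hy
  rcases lt_trichotomy x y with e | e | e
  · have := h1 x y hx.1 e (by omega); omega
  · exact e
  · have := h1 y x hy.1 e (by omega); omega

theorem aux_card_gt (m : ℕ) (a : ℕ → ℕ) (k : ℕ) (J : ℕ → ℕ) (hJ : JumpEnum m a k J)
    (c : ℕ) (hc : 1 ≤ c) (hck : c ≤ k) :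
    Set.ncard {j | IsJumpIdx m a j ∧ J c < j} = k - c := by
  obtain ⟨h1, h2, h3, h4, h5⟩ := hJ
  have mono : ∀ x y, 1 ≤ x → x ≤ k → 1 ≤ y → y ≤ k → J x < J y → x < y := by
    intro x y _ _ _ _ h
    by_contra hh
    rcases (not_lt.1 hh).eq_or_lt with e | e
    · subst e; omega
    · have := h1 y x ‹_› e ‹_›; omega
  have : {j | IsJumpIdx m a j ∧ J c < j} = J '' (Finset.Ioc c k : Finset ℕ) := by
    ext j
    simp only [Set.mem_setOf_eq, Set.mem_image, Finset.coe_Ioc, Set.mem_Ioc]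
    constructor
    · rintro ⟨p, q⟩
      obtain ⟨x, x1, x2, rfl⟩ := h3 j p
      exact ⟨x, ⟨mono c x hc hck x1 x2 q, x2⟩, rfl⟩
    · rintro ⟨x, ⟨x1, x2⟩, rfl⟩
      exact ⟨h2 x (by omega) (by omega), h1 c x hc x1 x2⟩
  rw [this, Set.ncard_image_of_injOn, Set.ncard_coe_finset, Nat.card_Ioc]
  intro x hx y hy h
  simp only [Finset.coe_Ioc, Set.mem_Ioc] at hx hy
  rcases lt_trichotomy x y with e | e | e
  · have := h1 x y (by omega) e (by omega); omega
  · exact e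
  · have := h1 y x (by omega) e (by omega); omega

theorem aux_card_symm (m : ℕ) (a : ℕ → ℕ) (x : ℕ) (hx : x ≤ m)
    (hs : ∀ j, 1 ≤ j → j < x → (IsJumpIdx m a j ↔ IsJumpIdx m a (m - j))) :
    Set.ncard {j | IsJumpIdx m a j ∧ j < x} = Set.ncard {j | IsJumpIdx m a j ∧ m - x < j} := by
  apply Set.ncard_congr (fun j _ => m - j)
  · rintro j ⟨p, q⟩
    exact ⟨(hs j p.1 q).1 p, by have := p.1; have := p.2.1; omega⟩
  · rintro i j ⟨p, q⟩ ⟨p', q'⟩ h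
    have := p.2.1; have := p'.2.1; have := p.1
    omega
  · rintro j ⟨p, q⟩
    have := p.2.1; have := p.1
    refine ⟨m - j, ⟨(hs (m-j) (by omega) (by omega)).2 ?_, by omega⟩, by omega⟩
    rwa [show m - (m - j) = j by omega]

theorem aux_comb (N M : ℕ) (a : ℕ → ℕ) (k : ℕ) (J : ℕ → ℕ) (hJ : JumpEnum (2*M+1) a k J)
    (hko : Odd k)
    (amono : ∀ j j', 1 ≤ j → j ≤ j' → j' ≤ 2*M+1 → a j ≤ a j')
    (asym : ∀ j, 1 ≤ j → j ≤ 2*M+1 → j ≠ M+1 → a (2*M+2-j) + a j = 2*N+1)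
    (amid : a (M+1) = N) (agt : ∀ j, M+1 < j → j ≤ 2*M+1 → N+1 ≤ a j) :
    ∃ c, 1 ≤ M ∧ 1 ≤ c ∧ k + 1 = 2 * c ∧ J c = M + 1 ∧ a M = N ∧ ¬ IsJumpIdx (2*M+1) a M ∧
      (∀ ρ, ρ ≤ k + 1 → ρ ≠ c → J (k+1-ρ) + J ρ = 2*M+1) := by
  have hJ' := hJ
  obtain ⟨h1, h2, h3, h4, h5⟩ := hJ
  have hk : 1 ≤ k := hko.pos
  have hM : 1 ≤ M := by
    obtain ⟨p, q, _⟩ := h2 1 le_rfl hk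
    omega
  have jM : IsJumpIdx (2*M+1) a (M+1) := by
    refine ⟨by omega, by omega, ?_⟩
    have := agt (M+1+1) (by omega) (by omega)
    omega
  obtain ⟨c, hc1, hc2, hc⟩ := h3 _ jM
  have hsym : ∀ j, 1 ≤ j → j < M →
      (IsJumpIdx (2*M+1) a j ↔ IsJumpIdx (2*M+1) a (2*M+1 - j)) := by
    intro j hj hjM
    have e1 := asym j hj (by omega) (by omega)
    have e2 := asym (j+1) (by omega) (by omega) (by omega)
    rw [show 2*M+2-(j+1) = 2*M+1-j by omega] at e2
    unfold IsJumpIdx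
    rw [show 2*M+1-j+1 = 2*M+2-j by omega]
    omega
  have cs := aux_card_symm (2*M+1) a M (by omega) hsym
  rw [show 2*M+1-M = M+1 by omega] at cs
  have cg := aux_card_gt _ a k J hJ' c hc1 hc2
  have cl := aux_card_lt _ a k J hJ' c hc1 hc2
  rw [hc] at cg cl
  have nj : ¬ IsJumpIdx (2*M+1) a M := by
    intro hjm
    obtain ⟨d, hd1, hd2, hd⟩ := h3 _ hjm
    have cl' := aux_card_lt _ a k J hJ' d hd1 hd2
    rw [hd] at cl'
    have hdc : d < c := by
      by_contra hh
      rcases (not_lt.1 hh).eq_or_lt with e | e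
      · subst e; omega
      · have := h1 c d hc1 e hd2; omega
    have : d + 1 = c := by
      by_contra hh
      have := h1 d (d+1) hd1 (by omega) (by omega)
      have := h1 (d+1) c (by omega) (by omega) hc2
      omega
    obtain ⟨t, ht⟩ := hko
    omega
  have hset : {j | IsJumpIdx (2*M+1) a j ∧ j < M + 1} = {j | IsJumpIdx (2*M+1) a j ∧ j < M} := by
    ext j
    simp only [Set.mem_setOf_eq]
    refine and_congr_right fun hj => ?_
    have : j ≠ M := by rintro rfl; exact nj hj
    omega
  rw [hset] at cl
  have kc : k + 1 = 2 * c := by omega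
  have aM : a M = N := by
    have := amono M (M+1) hM (by omega) (by omega)
    by_contra hh
    exact nj ⟨hM, by omega, by omega⟩
  have key : ∀ ρ, 1 ≤ ρ → ρ < c → J (k+1-ρ) + J ρ = 2*M+1 := by
    intro ρ hρ hρc
    have b1 := h1 ρ c hρ hρc hc2
    have jj := h2 ρ hρ (by omega)
    have b2 : J ρ ≠ M := by intro h; rw [h] at jj; exact nj jj
    have jj' := (hsym (J ρ) jj.1 (by omega)).1 jj
    obtain ⟨σ, s1, s2, hs⟩ := h3 _ jj'
    have e1 := aux_card_gt _ a k J hJ' σ s1 s2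
    have e2 := aux_card_lt _ a k J hJ' ρ hρ (by omega)
    have e3 := aux_card_symm (2*M+1) a (J ρ) (by omega) (fun j x y => hsym j x (by omega))
    rw [hs] at e1
    have : σ = k + 1 - ρ := by omega
    rw [← this, hs]
    omega
  refine ⟨c, hM, hc1, kc, hc, aM, nj, ?_⟩
  intro ρ hρ hρc
  rcases Nat.eq_zero_or_pos ρ with rfl | hp
  · rw [Nat.sub_zero]; omega
  rcases hρ.eq_or_lt with rfl | hlt
  · rw [Nat.sub_self]; omega
  rcases lt_or_gt_of_ne hρc with h | h
  · exact key ρ hp h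
  · have := key (k+1-ρ) (by omega) (by omega)
    rw [show k+1-(k+1-ρ) = ρ by omega] at this
    omega

theorem weights_u_v_exceptional_even_r
    (n m : ℕ) (hn : 1 ≤ n) (hm : 1 ≤ m) (hno : Odd n) (hmo : Odd m)
    (hnm : ¬(n = 1 ∧ m = 1))
    (w w' : ℤ) (l l' : ℕ → ℤ) (μ ν : ℕ → ℤ)
    (hl : IsLanglandsParam n w l) (hl' : IsLanglandsParam m w' l')
    (hμ : IsDominantPure n μ w) (hν : IsDominantPure m ν w')
    (hcorr : Corresponds n w l μ) (hcorr' : Corresponds m w' l' ν)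
    (hfirst : l' 1 < l 1)
    (hdisj : ∀ i ∈ Finset.Icc 1 n, ∀ j ∈ Finset.Icc 1 m,
      (i, j) ≠ ((n + 1) / 2, (m + 1) / 2) → l i ≠ l' j)
    (a : ℕ → ℕ) (ha : IsPositionTuple n m l l' a)
    (k : ℕ) (J : ℕ → ℕ) (hJ : JumpEnum m a k J) (hko : Odd k)
    (r : ℕ) (hr : r = k + 1)
    (lam : ℕ → ℤ) (hlam : ∀ j, lam j = ν j + (a j : ℤ) - (j : ℤ))
    (μd : ℕ → ℤ) (hμd : ∀ i, μd i = - μ (n + 1 - i))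
    (s : ℤ) (u v : ℕ → ℤ)
    (hu : ∀ ρ, 1 ≤ ρ → ρ ≤ r →
      u (2 * ρ - 1) = μd (a (J ρ)) ∧ u (2 * ρ) = μd (1 + a (J ρ)))
    (hv : ∀ ρ, 1 ≤ ρ → ρ ≤ r → ρ ≠ r / 2 →
      v (2 * ρ - 1) = lam (1 + J (ρ - 1)) - s ∧ v (2 * ρ) = lam (J ρ) - s)
    (hvmid : v (r - 1) = lam (1 + J (r / 2 - 1)) - s ∧ v r = lam (J (r / 2) - 1) - s) :
    MemX0 (2 * r) u ∧ MemX0 (2 * r) v ∧ u r = u (r + 1) := by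
  obtain ⟨N, rfl⟩ := hno
  obtain ⟨M, rfl⟩ := hmo
  obtain ⟨amono, asym, amid, agt⟩ := aux_pos N M l l' w w' hl hl' hdisj a ha
  have lstep := aux_lam N M l l' μ ν w w' hl hl' hμ hν hcorr hcorr' a ha amono
  obtain ⟨c, hM, hc1, kc, Jc, aM, nj, Jsym⟩ := aux_comb N M a k J hJ hko amono asym amid agt
  obtain ⟨h1, h2, h3, h4, h5⟩ := hJ
  have hrc : r = 2 * c := by omega
  have hrc2 : r / 2 = c := by omega
  rw [hrc2] at hv hvmid
  have lanti : ∀ i i', 1 ≤ i → i ≤ i' → i' ≤ 2*M+1 → lam i' ≤ lam i := by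
    intro i i' x y z
    refine aux_anti_s17 (2*M+1) lam ?_ i i' x y z
    intro j p q
    rw [hlam, hlam]
    exact lstep j p q
  have lsym : ∀ j, 1 ≤ j → j ≤ 2*M+1 → j ≠ M+1 →
      lam j + lam (2*M+2-j) = w' + (2*N+1) - (2*M+2) := by
    intro j p q hne
    have e1 := asym j p q hne
    have e2 := hν.2 j p q
    rw [show 2*M+1+1-j = 2*M+2-j by omega] at e2
    rw [hlam, hlam]
    omega
  -- J strictly monotone step
  have Jstep : ∀ ρ, 1 ≤ ρ → ρ ≤ r → J (ρ-1) < J ρ := by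
    intro ρ p q
    rcases p.eq_or_lt with rfl | p'
    · rw [Nat.sub_self, h4]
      rcases q.eq_or_lt with e | e
      · omega
      · exact (h2 1 le_rfl (by omega)).1
    rcases q.eq_or_lt with e | e
    · rw [e, hr, h5, Nat.add_sub_cancel]
      have := (h2 k (by omega) (by omega)).2.1
      omega
    · exact h1 _ _ (by omega) (by omega) (by omega)
  have Jle : ∀ ρ, ρ ≤ r → J ρ ≤ 2*M+1 := by
    intro ρ q
    rcases Nat.eq_zero_or_pos ρ with rfl | p
    · omega
    rcases q.eq_or_lt with e | e
    · rw [e, hr, h5]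
    · have := (h2 ρ p (by omega)).2.1; omega
  have JneM : ∀ ρ, ρ ≤ r → J ρ ≠ M := by
    intro ρ q h
    rcases Nat.eq_zero_or_pos ρ with rfl | p
    · omega
    rcases q.eq_or_lt with e | e
    · rw [e, hr, h5] at h; omega
    · have := h2 ρ p (by omega)
      rw [h] at this
      exact nj this
  have aconst : ∀ ρ, 1 ≤ ρ → ρ ≤ r → a (J ρ) = a (1 + J (ρ-1)) := by
    intro ρ p q
    have hlt := Jstep ρ p q
    have gen : ∀ x, 1 + J (ρ-1) ≤ x → x ≤ J ρ → a x = a (1 + J (ρ-1)) := by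
      intro x hx
      induction x, hx using Nat.le_induction with
      | base => intro _; rfl
      | succ x hx ih =>
        intro hle
        rw [← ih (by omega)]
        have b := Jle ρ q
        have mm := amono x (x+1) (by omega) (by omega) (by omega)
        by_contra hne
        obtain ⟨d, d1, d2, hd⟩ := h3 x ⟨by omega, by omega, by omega⟩
        rcases lt_trichotomy d (ρ-1) with e | e | e
        · have := h1 d (ρ-1) d1 e (by omega); omega
        · rw [e] at hd; omega
        · by_cases e' : d = ρ
          · rw [e'] at hd; omega
          · have := h1 ρ d p (by omega) d2; omega
    exact gen _ (by omega) le_rfl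
  have ale : ∀ ρ, 1 ≤ ρ → ρ ≤ r → 1 ≤ a (J ρ) ∧ a (J ρ) ≤ 2*N := by
    intro ρ p q
    have := Jstep ρ p q
    obtain ⟨x, y, _⟩ := ha (J ρ) (by omega) (Jle ρ q)
    omega
  have aJ : ∀ ρ, 1 ≤ ρ → ρ ≤ r → a (J (r+1-ρ)) + a (J ρ) = 2*N+1 := by
    intro ρ p q
    have hlt := Jstep ρ p q
    have b := Jle ρ q
    rw [aconst ρ p q]
    by_cases h : ρ - 1 = c
    · rw [show r+1-ρ = c by omega, h, Jc, amid]
      have := asym M hM (by omega) (by omega)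
      rw [show 2*M+2-M = 1+(M+1) by omega] at this
      omega
    · have e := Jsym (ρ-1) (by omega) h
      have e' := asym (1 + J (ρ-1)) (by omega) (by omega) (by have := JneM (ρ-1) (by omega); omega)
      rw [show 2*M+2-(1 + J (ρ-1)) = J (k+1-(ρ-1)) by omega,
        show k+1-(ρ-1) = r+1-ρ by omega] at e'
      exact e'
  have mda : ∀ i i', 1 ≤ i → i ≤ i' → i' ≤ 2*N+1 → μd i' ≤ μd i := by
    intro i i' x y z
    rw [hμd, hμd]
    have := aux_anti_s17 (2*N+1) μ hμ.1 (2*N+1+1-i') (2*N+1+1-i) (by omega) (by omega) (by omega)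
    omega
  have mds : ∀ i i', 1 ≤ i → i ≤ 2*N+1 → i + i' = 2*N+2 → μd i + μd i' = -w := by
    intro i i' x y z
    rw [hμd, hμd]
    have := hμ.2 i x y
    rw [show 2*N+1+1-i = i' by omega, show 2*N+1+1-i' = i by omega] at *
    omega
  obtain ⟨e, he⟩ : ∃ e : ℕ → ℕ, ∀ ρ, e ρ = if ρ = c then M else J ρ := ⟨_, fun _ => rfl⟩
  have hv' : ∀ ρ, 1 ≤ ρ → ρ ≤ r →
      v (2 * ρ - 1) = lam (1 + J (ρ - 1)) - s ∧ v (2 * ρ) = lam (e ρ) - s := by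
    intro ρ p q
    by_cases h : ρ = c
    · rw [he, if_pos h, h, ← hrc, hvmid.1, hvmid.2, Jc]
      exact ⟨rfl, rfl⟩
    · rw [he, if_neg h]
      exact hv ρ p q h
  have hee : ∀ ρ, 1 ≤ ρ → ρ ≤ r → J (ρ-1) < e ρ ∧ e ρ ≤ J ρ ∧ e (r+1-ρ) + J (ρ-1) = 2*M+1 := by
    intro ρ p q
    have hlt := Jstep ρ p q
    have hne := JneM (ρ-1) (by omega)
    rw [he, he]
    refine ⟨?_, ?_, ?_⟩
    · split_ifs with h
      · subst h; omega
      · exact hlt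
    · split_ifs with h
      · subst h; omega
      · exact le_rfl
    · split_ifs with h
      · rw [show ρ - 1 = c by omega]; omega
      · have := Jsym (ρ-1) (by omega) (by omega)
        rw [show k+1-(ρ-1) = r+1-ρ by omega] at this
        exact this
  have usum : ∀ ρ, 1 ≤ ρ → ρ ≤ r → u (2*ρ-1) + u (2*(r+1-ρ)) = -w := by
    intro ρ p q
    rw [(hu ρ p q).1, (hu (r+1-ρ) (by omega) (by omega)).2]
    have := ale ρ p q
    have := aJ ρ p q
    exact mds _ _ (by omega) (by omega) (by omega)
  have vsum : ∀ ρ, 1 ≤ ρ → ρ ≤ r →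
      v (2*ρ-1) + v (2*(r+1-ρ)) = w' + (2*N+1) - (2*M+2) - 2 * s := by
    intro ρ p q
    rw [(hv' ρ p q).1, (hv' (r+1-ρ) (by omega) (by omega)).2]
    have b1 := hee ρ p q
    have b2 := Jle ρ q
    have hne := JneM (ρ-1) (by omega)
    have := lsym (1 + J (ρ-1)) (by omega) (by omega) (by omega)
    rw [show 2*M+2-(1 + J (ρ-1)) = e (r+1-ρ) by omega] at this
    omega
  have pure_of : ∀ (f : ℕ → ℤ) (W : ℤ),
      (∀ ρ, 1 ≤ ρ → ρ ≤ r → f (2*ρ-1) + f (2*(r+1-ρ)) = W) →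
      ∀ i, 1 ≤ i → i ≤ 2*r → f i + f (2*r+1-i) = W := by
    intro f W hf i p q
    rcases Nat.even_or_odd' i with ⟨t, rfl | rfl⟩
    · have := hf (r+1-t) (by omega) (by omega)
      rw [show r+1-(r+1-t) = t by omega, show 2*(r+1-t)-1 = 2*r+1-2*t by omega] at this
      omega
    · have := hf (t+1) (by omega) (by omega)
      rw [show 2*(t+1)-1 = 2*t+1 by omega,
        show 2*(r+1-(t+1)) = 2*r+1-(2*t+1) by omega] at this
      exact this
  refine ⟨⟨-w, ?_, pure_of u _ usum⟩, ⟨_, ?_, pure_of v _ vsum⟩, ?_⟩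
  · intro i p q
    rcases Nat.even_or_odd' i with ⟨t, rfl | rfl⟩
    · have x1 := (hu t (by omega) (by omega)).2
      have x2 := (hu (t+1) (by omega) (by omega)).1
      rw [show 2*(t+1)-1 = 2*t+1 by omega] at x2
      rw [x1, x2]
      have b1 := ale (t+1) (by omega) (by omega)
      have b2 := ale t (by omega) (by omega)
      refine mda _ _ (by omega) ?_ (by omega)
      have := (h2 t (by omega) (by omega)).2.2
      have := aconst (t+1) (by omega) (by omega)
      rw [Nat.add_sub_cancel, Nat.add_comm 1] at this
      omega
    · have x := hu (t+1) (by omega) (by omega)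
      rw [show 2*(t+1)-1 = 2*t+1 by omega] at x
      rw [show 2*t+1+1 = 2*(t+1) by omega, x.1, x.2]
      have b1 := ale (t+1) (by omega) (by omega)
      exact mda _ _ (by omega) (by omega) (by omega)
  · intro i p q
    rcases Nat.even_or_odd' i with ⟨t, rfl | rfl⟩
    · have x1 := (hv' t (by omega) (by omega)).2
      have x2 := (hv' (t+1) (by omega) (by omega)).1
      rw [show 2*(t+1)-1 = 2*t+1 by omega, Nat.add_sub_cancel] at x2
      rw [x1, x2]
      have b1 := hee t (by omega) (by omega)
      have b2 := Jle (t+1) (by omega)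
      have b3 := Jstep (t+1) (by omega) (by omega)
      rw [Nat.add_sub_cancel] at b3
      have := lanti (e t) (1 + J t) (by omega) (by omega) (by omega)
      omega
    · have x := hv' (t+1) (by omega) (by omega)
      rw [show 2*(t+1)-1 = 2*t+1 by omega] at x
      rw [show 2*t+1+1 = 2*(t+1) by omega, x.1, x.2]
      have b1 := hee (t+1) (by omega) (by omega)
      have b2 := Jle (t+1) (by omega)
      have := lanti (1 + J (t+1-1)) (e (t+1)) (by omega) (by omega) (by omega)
      omega
  · have x1 := (hu c (by omega) (by omega)).2
    have x2 := (hu (c+1) (by omega) (by omega)).1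
    rw [show 2*(c+1)-1 = r+1 by omega] at x2
    rw [← hrc] at x1
    rw [x1, x2]
    have := aJ c (by omega) (by omega)
    rw [show r+1-c = c+1 by omega, Jc, amid] at this
    rw [Jc, amid]
    congr 1
    omega
end
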